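/- Let ν be a σ-finite Borel measure on (0,∞) with M₁ = ∫₀^∞ z ν(dz) ∈ (0,1), let ρ be a Borel probability measure on (0,∞), w ∈ [0,1], θ ≥ 0, T > 0. If φ₁ and φ₂ are two nonnegative bounded continuous functions on [0,T] × (0,∞) each satisfying, for all t ∈ [0,T] and r > 0, φᵢ(t,r) = θ·e^{−r t} + ∫₀ᵗ e^{−r(t−s)} r [ w ∫₀^∞ (1 − e^{−φᵢ(s,r) z}) ν(dz) + (1−w) ∫₀^∞ ∫₀^∞ (1 − e^{−φᵢ(s,u) z}) ν(dz) ρ(du) ] ds, then φ₁ = φ₂ on [0,T] × (0,∞). -/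

import Mathlib

open MeasureTheory

/-- The Riccati operator `𝔾` of the aggregation model. -/
noncomputable def riccatiOp (ν ρ : Measure ℝ) (w θ : ℝ)
    (φ : ℝ → ℝ → ℝ) (t r : ℝ) : ℝ :=
  θ * Real.exp (-(r * t)) +
    ∫ s in (0:ℝ)..t, Real.exp (-(r * (t - s))) * r *
      (w * (∫ z in Set.Ioi (0:ℝ), (1 - Real.exp (-(φ s r * z))) ∂ν) +
       (1 - w) * ∫ u in Set.Ioi (0:ℝ),
          (∫ z in Set.Ioi (0:ℝ), (1 - Real.exp (-(φ s u * z))) ∂ν) ∂ρ)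

open Set

lemma abs_exp_neg_sub_exp_neg_le {a b : ℝ} (ha : 0 ≤ a) (hb : 0 ≤ b) :
    |Real.exp (-a) - Real.exp (-b)| ≤ |a - b| := by
  wlog h : a ≤ b generalizing a b
  · rw [abs_sub_comm, abs_sub_comm a]
    exact this hb ha (le_of_not_ge h)
  have h1 : Real.exp (-b) = Real.exp (-a) * Real.exp (-(b - a)) := by
    rw [← Real.exp_add]; ring_nf
  have h2 : Real.exp (-a) ≤ 1 := Real.exp_le_one_iff.2 (by linarith)
  have h3 : Real.exp (-(b - a)) ≤ 1 := Real.exp_le_one_iff.2 (by linarith)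
  have h4 := Real.add_one_le_exp (-(b - a))
  rw [abs_of_nonneg (sub_nonneg.2 (Real.exp_le_exp.2 (by linarith))),
    abs_of_nonpos (by linarith : a - b ≤ 0), h1]
  nlinarith [Real.exp_pos (-a)]

section LaplaceExponent

variable {ν : Measure ℝ}

lemma integrableOn_one_sub_exp_neg_mul (hν : IntegrableOn (fun z : ℝ => z) (Ioi 0) ν)
    {x : ℝ} (hx : 0 ≤ x) :
    IntegrableOn (fun z : ℝ => 1 - Real.exp (-(x * z))) (Ioi 0) ν := by
  refine (hν.const_mul x).mono' (by fun_prop) ?_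
  filter_upwards [ae_restrict_mem measurableSet_Ioi] with z hz
  have hxz : 0 ≤ x * z := mul_nonneg hx (le_of_lt hz)
  simpa [abs_of_nonneg hx, abs_of_pos (mem_Ioi.1 hz)] using
    abs_exp_neg_sub_exp_neg_le le_rfl hxz

lemma abs_integral_one_sub_exp_neg_mul_sub_le
    (hν : IntegrableOn (fun z : ℝ => z) (Ioi 0) ν) {x y : ℝ} (hx : 0 ≤ x) (hy : 0 ≤ y) :
    |(∫ z in Ioi (0:ℝ), (1 - Real.exp (-(x * z))) ∂ν) -
        ∫ z in Ioi (0:ℝ), (1 - Real.exp (-(y * z))) ∂ν| ≤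
      (∫ z in Ioi (0:ℝ), z ∂ν) * |x - y| := by
  rw [← integral_sub (integrableOn_one_sub_exp_neg_mul hν hx)
    (integrableOn_one_sub_exp_neg_mul hν hy), ← integral_mul_const]
  refine (Real.norm_eq_abs _).ge.trans (norm_integral_le_of_norm_le (hν.mul_const _) ?_)
  filter_upwards [ae_restrict_mem measurableSet_Ioi] with z hz
  have hz : 0 < z := hz
  have h := abs_exp_neg_sub_exp_neg_le (mul_nonneg hy hz.le) (mul_nonneg hx hz.le)
  rw [← sub_mul, abs_mul, abs_of_pos hz, abs_sub_comm y] at h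
  rw [Real.norm_eq_abs, sub_sub_sub_cancel_left, mul_comm z]
  exact h

lemma continuousOn_integral_one_sub_exp_neg_mul
    (hν : IntegrableOn (fun z : ℝ => z) (Ioi 0) ν) :
    ContinuousOn (fun x : ℝ => ∫ z in Ioi (0:ℝ), (1 - Real.exp (-(x * z))) ∂ν) (Ici 0) := by
  refine LipschitzOnWith.continuousOn (K := (∫ z in Ioi (0:ℝ), z ∂ν).toNNReal) ?_
  refine LipschitzOnWith.of_dist_le_mul fun x hx y hy => ?_
  rw [Real.coe_toNNReal _ (setIntegral_nonneg measurableSet_Ioi fun z hz => le_of_lt hz)]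
  exact abs_integral_one_sub_exp_neg_mul_sub_le hν hx hy

end LaplaceExponent

lemma integral_exp_neg_mul_sub_mul (r t : ℝ) :
    ∫ s in (0:ℝ)..t, Real.exp (-(r * (t - s))) * r = 1 - Real.exp (-(r * t)) := by
  have h : ∀ s ∈ uIcc 0 t,
      HasDerivAt (fun s => Real.exp (-(r * (t - s)))) (Real.exp (-(r * (t - s))) * r) s := by
    intro s _
    have h1 := ((((hasDerivAt_id s).const_sub t).const_mul r).neg).exp
    simpa using h1
  rw [intervalIntegral.integral_eq_sub_of_hasDerivAt h
    (Continuous.intervalIntegrable (by fun_prop) _ _)]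
  simp

lemma abs_integral_exp_neg_mul_sub_le {F₁ F₂ : ℝ → ℝ} {r t B : ℝ} (hr : 0 < r) (ht : 0 ≤ t)
    (hB : 0 ≤ B) (hF₁ : ContinuousOn F₁ (Icc 0 t)) (hF₂ : ContinuousOn F₂ (Icc 0 t))
    (hF : ∀ s ∈ Icc 0 t, |F₁ s - F₂ s| ≤ B) :
    |(∫ s in (0:ℝ)..t, Real.exp (-(r * (t - s))) * r * F₁ s) -
        ∫ s in (0:ℝ)..t, Real.exp (-(r * (t - s))) * r * F₂ s| ≤ B := by
  have hint {F : ℝ → ℝ} (hF : ContinuousOn F (Icc 0 t)) :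
      IntervalIntegrable (fun s => Real.exp (-(r * (t - s))) * r * F s) volume 0 t :=
    ContinuousOn.intervalIntegrable_of_Icc ht (by fun_prop)
  rw [← intervalIntegral.integral_sub (hint hF₁) (hint hF₂)]
  rw [← Real.norm_eq_abs]
  calc _ ≤ ∫ s in (0:ℝ)..t, Real.exp (-(r * (t - s))) * r * B := by
        refine intervalIntegral.norm_integral_le_of_norm_le ht
          (Filter.Eventually.of_forall fun s hs => ?_)
          (hint continuousOn_const)
        rw [← mul_sub, norm_mul, Real.norm_of_nonneg (by positivity)]
        exact mul_le_mul_of_nonneg_left (hF s (Ioc_subset_Icc_self hs)) (by positivity)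
    _ = (1 - Real.exp (-(r * t))) * B := by
        rw [intervalIntegral.integral_mul_const, integral_exp_neg_mul_sub_mul]
    _ ≤ B := mul_le_of_le_one_left hB (by linarith [Real.exp_pos (-(r * t))])

section Riccati

variable {ν ρ : Measure ℝ} {φ φ₁ φ₂ : ℝ → ℝ → ℝ} {T C D : ℝ}

lemma integrableOn_integral_one_sub_exp_neg_mul [IsFiniteMeasure ρ]
    (hν : IntegrableOn (fun z : ℝ => z) (Ioi 0) ν) {f : ℝ → ℝ} (hc : ContinuousOn f (Ioi 0))
    (hb : ∀ r ∈ Ioi (0:ℝ), |f r| ≤ C) (hnn : ∀ r ∈ Ioi (0:ℝ), 0 ≤ f r) :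
    IntegrableOn (fun u => ∫ z in Ioi (0:ℝ), (1 - Real.exp (-(f u * z))) ∂ν) (Ioi 0) ρ := by
  have hm : ContinuousOn (fun u => ∫ z in Ioi (0:ℝ), (1 - Real.exp (-(f u * z))) ∂ν) (Ioi 0) :=
    (continuousOn_integral_one_sub_exp_neg_mul hν).comp hc hnn
  refine (integrable_const ((∫ z in Ioi (0:ℝ), z ∂ν) * C)).mono'
    (hm.aestronglyMeasurable measurableSet_Ioi) ?_
  filter_upwards [ae_restrict_mem measurableSet_Ioi] with u hu
  have h := abs_integral_one_sub_exp_neg_mul_sub_le hν (hnn u hu) le_rfl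
  simp only [zero_mul, neg_zero, Real.exp_zero, sub_self, integral_zero, sub_zero] at h
  exact h.trans (mul_le_mul_of_nonneg_left (hb u hu)
    (setIntegral_nonneg measurableSet_Ioi fun z hz => le_of_lt hz))

lemma continuousOn_integral_integral_one_sub_exp_neg_mul [IsFiniteMeasure ρ]
    (hν : IntegrableOn (fun z : ℝ => z) (Ioi 0) ν)
    (hc : ContinuousOn (fun p : ℝ × ℝ => φ p.1 p.2) (Icc 0 T ×ˢ Ioi 0))
    (hb : ∀ t ∈ Icc (0:ℝ) T, ∀ r ∈ Ioi (0:ℝ), |φ t r| ≤ C)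
    (hnn : ∀ t ∈ Icc (0:ℝ) T, ∀ r ∈ Ioi (0:ℝ), 0 ≤ φ t r) :
    ContinuousOn (fun s => ∫ u in Ioi (0:ℝ),
      (∫ z in Ioi (0:ℝ), (1 - Real.exp (-(φ s u * z))) ∂ν) ∂ρ) (Icc 0 T) := by
  refine continuousOn_of_dominated (bound := fun _ => (∫ z in Ioi (0:ℝ), z ∂ν) * C)
    ?_ ?_ (integrable_const _) ?_
  · intro s hs
    exact (integrableOn_integral_one_sub_exp_neg_mul hν (hc.uncurry_left s hs)
      (hb s hs) (hnn s hs)).aestronglyMeasurable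
  · intro s hs
    filter_upwards [ae_restrict_mem measurableSet_Ioi] with u hu
    have h := abs_integral_one_sub_exp_neg_mul_sub_le hν (hnn s hs u hu) le_rfl
    simp only [zero_mul, neg_zero, Real.exp_zero, sub_self, integral_zero, sub_zero] at h
    exact h.trans (mul_le_mul_of_nonneg_left (hb s hs u hu)
      (setIntegral_nonneg measurableSet_Ioi fun z hz => le_of_lt hz))
  · filter_upwards [ae_restrict_mem measurableSet_Ioi] with u hu
    exact (continuousOn_integral_one_sub_exp_neg_mul hν).comp
      (hc.uncurry_right u hu) fun s hs => hnn s hs u hu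

lemma abs_integral_integral_one_sub_exp_neg_mul_sub_le [IsProbabilityMeasure ρ]
    (hν : IntegrableOn (fun z : ℝ => z) (Ioi 0) ν) {f₁ f₂ : ℝ → ℝ} {C₁ C₂ : ℝ}
    (hc₁ : ContinuousOn f₁ (Ioi 0)) (hc₂ : ContinuousOn f₂ (Ioi 0))
    (hb₁ : ∀ r ∈ Ioi (0:ℝ), |f₁ r| ≤ C₁) (hb₂ : ∀ r ∈ Ioi (0:ℝ), |f₂ r| ≤ C₂)
    (hnn₁ : ∀ r ∈ Ioi (0:ℝ), 0 ≤ f₁ r) (hnn₂ : ∀ r ∈ Ioi (0:ℝ), 0 ≤ f₂ r)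
    (hD : 0 ≤ D) (h : ∀ r ∈ Ioi (0:ℝ), |f₁ r - f₂ r| ≤ D) :
    |(∫ u in Ioi (0:ℝ), (∫ z in Ioi (0:ℝ), (1 - Real.exp (-(f₁ u * z))) ∂ν) ∂ρ) -
        ∫ u in Ioi (0:ℝ), (∫ z in Ioi (0:ℝ), (1 - Real.exp (-(f₂ u * z))) ∂ν) ∂ρ| ≤
      (∫ z in Ioi (0:ℝ), z ∂ν) * D := by
  have hM : 0 ≤ ∫ z in Ioi (0:ℝ), z ∂ν :=
    setIntegral_nonneg measurableSet_Ioi fun z hz => le_of_lt hz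
  rw [← integral_sub (integrableOn_integral_one_sub_exp_neg_mul hν hc₁ hb₁ hnn₁)
    (integrableOn_integral_one_sub_exp_neg_mul hν hc₂ hb₂ hnn₂), ← Real.norm_eq_abs]
  refine (norm_setIntegral_le_of_norm_le_const (C := (∫ z in Ioi (0:ℝ), z ∂ν) * D)
    (measure_lt_top ρ _) fun u hu => ?_).trans
    (mul_le_of_le_one_right (mul_nonneg hM hD) measureReal_le_one)
  exact (abs_integral_one_sub_exp_neg_mul_sub_le hν (hnn₁ u hu) (hnn₂ u hu)).trans
    (mul_le_mul_of_nonneg_left (h u hu) hM)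

/-- The Riccati operator is Lipschitz in the supremum norm, with constant the first moment. -/
lemma abs_riccatiOp_sub_le [IsProbabilityMeasure ρ]
    (hν : IntegrableOn (fun z : ℝ => z) (Ioi 0) ν) {w : ℝ} (hw : w ∈ Icc (0:ℝ) 1) (θ : ℝ)
    {C₁ C₂ : ℝ}
    (hc₁ : ContinuousOn (fun p : ℝ × ℝ => φ₁ p.1 p.2) (Icc 0 T ×ˢ Ioi 0))
    (hc₂ : ContinuousOn (fun p : ℝ × ℝ => φ₂ p.1 p.2) (Icc 0 T ×ˢ Ioi 0))
    (hb₁ : ∀ t ∈ Icc (0:ℝ) T, ∀ r ∈ Ioi (0:ℝ), |φ₁ t r| ≤ C₁)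
    (hb₂ : ∀ t ∈ Icc (0:ℝ) T, ∀ r ∈ Ioi (0:ℝ), |φ₂ t r| ≤ C₂)
    (hnn₁ : ∀ t ∈ Icc (0:ℝ) T, ∀ r ∈ Ioi (0:ℝ), 0 ≤ φ₁ t r)
    (hnn₂ : ∀ t ∈ Icc (0:ℝ) T, ∀ r ∈ Ioi (0:ℝ), 0 ≤ φ₂ t r)
    (hD : 0 ≤ D) (h : ∀ t ∈ Icc (0:ℝ) T, ∀ r ∈ Ioi (0:ℝ), |φ₁ t r - φ₂ t r| ≤ D)
    {t r : ℝ} (ht : t ∈ Icc 0 T) (hr : r ∈ Ioi (0:ℝ)) :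
    |riccatiOp ν ρ w θ φ₁ t r - riccatiOp ν ρ w θ φ₂ t r| ≤ (∫ z in Ioi (0:ℝ), z ∂ν) * D := by
  have hM : 0 ≤ ∫ z in Ioi (0:ℝ), z ∂ν :=
    setIntegral_nonneg measurableSet_Ioi fun z hz => le_of_lt hz
  have hsub : Icc 0 t ⊆ Icc 0 T := Icc_subset_Icc_right ht.2
  rw [riccatiOp, riccatiOp, add_sub_add_left_eq_sub]
  refine abs_integral_exp_neg_mul_sub_le hr ht.1 (mul_nonneg hM hD) ?_ ?_ fun s hs => ?_
  · exact ((continuousOn_const.mul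
      ((continuousOn_integral_one_sub_exp_neg_mul hν).comp (hc₁.uncurry_right r hr)
        fun s hs => hnn₁ s hs r hr)).add (continuousOn_const.mul
      (continuousOn_integral_integral_one_sub_exp_neg_mul hν hc₁ hb₁ hnn₁))).mono hsub
  · exact ((continuousOn_const.mul
      ((continuousOn_integral_one_sub_exp_neg_mul hν).comp (hc₂.uncurry_right r hr)
        fun s hs => hnn₂ s hs r hr)).add (continuousOn_const.mul
      (continuousOn_integral_integral_one_sub_exp_neg_mul hν hc₂ hb₂ hnn₂))).mono hsub
  · have hs := hsub hs
    have h1 := (abs_integral_one_sub_exp_neg_mul_sub_le hν (hnn₁ s hs r hr)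
      (hnn₂ s hs r hr)).trans (mul_le_mul_of_nonneg_left (h s hs r hr) hM)
    have h2 := abs_integral_integral_one_sub_exp_neg_mul_sub_le (ρ := ρ) hν
      (hc₁.uncurry_left s hs) (hc₂.uncurry_left s hs) (hb₁ s hs) (hb₂ s hs)
      (hnn₁ s hs) (hnn₂ s hs) hD (h s hs)
    have hw' : 0 ≤ 1 - w := sub_nonneg.2 hw.2
    rw [abs_le] at h1 h2 ⊢
    constructor
    · linarith [mul_le_mul_of_nonneg_left h1.1 hw.1, mul_le_mul_of_nonneg_left h2.1 hw']
    · linarith [mul_le_mul_of_nonneg_left h1.2 hw.1, mul_le_mul_of_nonneg_left h2.2 hw']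

end Riccati

/-- Uniqueness of nonnegative bounded continuous solutions of the mild generalized
Riccati equation of the aggregation model. -/
theorem riccati_uniqueness
    (ν ρ : Measure ℝ) [SigmaFinite ν] [IsProbabilityMeasure ρ]
    (hν : ν (Set.Iic 0) = 0) (hρ : ρ (Set.Iic 0) = 0)
    (hνInt : IntegrableOn (fun z : ℝ => z) (Set.Ioi 0) ν)
    (M₁ : ℝ) (hM₁ : M₁ = ∫ z in Set.Ioi (0:ℝ), z ∂ν)
    (hM₁pos : 0 < M₁) (hM₁lt : M₁ < 1)
    (w : ℝ) (hw : w ∈ Set.Icc (0:ℝ) 1)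
    (θ : ℝ) (hθ : 0 ≤ θ) (T : ℝ) (hT : 0 < T)
    (φ₁ φ₂ : ℝ → ℝ → ℝ)
    (hφ₁c : ContinuousOn (fun p : ℝ × ℝ => φ₁ p.1 p.2) (Set.Icc 0 T ×ˢ Set.Ioi 0))
    (hφ₂c : ContinuousOn (fun p : ℝ × ℝ => φ₂ p.1 p.2) (Set.Icc 0 T ×ˢ Set.Ioi 0))
    (hφ₁b : ∃ C : ℝ, ∀ t ∈ Set.Icc (0:ℝ) T, ∀ r ∈ Set.Ioi (0:ℝ), |φ₁ t r| ≤ C)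
    (hφ₂b : ∃ C : ℝ, ∀ t ∈ Set.Icc (0:ℝ) T, ∀ r ∈ Set.Ioi (0:ℝ), |φ₂ t r| ≤ C)
    (hφ₁nn : ∀ t ∈ Set.Icc (0:ℝ) T, ∀ r ∈ Set.Ioi (0:ℝ), 0 ≤ φ₁ t r)
    (hφ₂nn : ∀ t ∈ Set.Icc (0:ℝ) T, ∀ r ∈ Set.Ioi (0:ℝ), 0 ≤ φ₂ t r)
    (hφ₁eq : ∀ t ∈ Set.Icc (0:ℝ) T, ∀ r ∈ Set.Ioi (0:ℝ),
      φ₁ t r = riccatiOp ν ρ w θ φ₁ t r)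
    (hφ₂eq : ∀ t ∈ Set.Icc (0:ℝ) T, ∀ r ∈ Set.Ioi (0:ℝ),
      φ₂ t r = riccatiOp ν ρ w θ φ₂ t r) :
    ∀ t ∈ Set.Icc (0:ℝ) T, ∀ r ∈ Set.Ioi (0:ℝ), φ₁ t r = φ₂ t r := by
  obtain ⟨C₁, hC₁⟩ := hφ₁b
  obtain ⟨C₂, hC₂⟩ := hφ₂b
  have hC : 0 ≤ C₁ + C₂ := by
    have h0 : (0:ℝ) ∈ Set.Icc 0 T := ⟨le_rfl, hT.le⟩
    exact add_nonneg ((abs_nonneg _).trans (hC₁ 0 h0 1 (Set.mem_Ioi.2 one_pos)))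
      ((abs_nonneg _).trans (hC₂ 0 h0 1 (Set.mem_Ioi.2 one_pos)))
  have key : ∀ n : ℕ, ∀ t ∈ Set.Icc (0:ℝ) T, ∀ r ∈ Set.Ioi (0:ℝ),
      |φ₁ t r - φ₂ t r| ≤ M₁ ^ n * (C₁ + C₂) := by
    intro n
    induction n with
    | zero =>
      intro t ht r hr
      rw [pow_zero, one_mul]
      exact (abs_sub _ _).trans (add_le_add (hC₁ t ht r hr) (hC₂ t ht r hr))
    | succ n ih =>
      intro t ht r hr
      rw [hφ₁eq t ht r hr, hφ₂eq t ht r hr, pow_succ', mul_assoc]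
      nth_rewrite 1 [hM₁]
      exact abs_riccatiOp_sub_le hνInt hw θ hφ₁c hφ₂c hC₁ hC₂ hφ₁nn hφ₂nn (by positivity) ih ht hr
  intro t ht r hr
  have hlim : Filter.Tendsto (fun n : ℕ => M₁ ^ n * (C₁ + C₂)) Filter.atTop (nhds 0) := by
    simpa using (tendsto_pow_atTop_nhds_zero_of_lt_one hM₁pos.le hM₁lt).mul_const (C₁ + C₂)
  have h := ge_of_tendsto' hlim fun n => key n t ht r hr
  exact sub_eq_zero.1 (abs_nonpos_iff.1 h)
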